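/- arXiv:2008.09259 — 2 statements merged into one kernel-verified Lean document; each statement's English description precedes it below -/
import Mathlib

section
/- Fix an integer k ≥ 2 and a real γ > −1. For integers n_1, …, n_k ≥ 2, set n − k = ∑_{i=1}^k (n_i − 1), a_i = (n_i − 1)/(n − k), N = (n − k)/2, and C = ∏_{i=1}^k a_i^{a_i}. Then for every ε > 0 there exists M such that whenever min_{1≤i≤k} n_i ≥ M, | C^{−Nγ} · ( Γ(N) / Γ(N(1+γ)) ) · ∏_{i=1}^k ( Γ(N a_i (1+γ)) / Γ(N a_i) ) − (1+γ)^{−(k−1)/2} | < ε. -/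
open Finset

open Filter Topology

/-- The remainder in Stirling's approximation of `log Γ`, up to the constant `log √(2π)`. -/
noncomputable def stirlingRemainder (x : ℝ) : ℝ :=
  Real.log (Real.Gamma x) - ((x - 1 / 2) * Real.log x - x)

lemma Gamma_eq_exp_stirlingRemainder {x : ℝ} (hx : 0 < x) :
    Real.Gamma x = Real.exp (stirlingRemainder x + ((x - 1 / 2) * Real.log x - x)) := by
  rw [stirlingRemainder, sub_add_cancel, Real.exp_log (Real.Gamma_pos_of_pos hx)]

lemma stirlingRemainder_natCast {n : ℕ} (hn : n ≠ 0) :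
    stirlingRemainder n = Real.log (Stirling.stirlingSeq n) + Real.log 2 / 2 := by
  have hpos : (0 : ℝ) < n := by positivity
  have hfac : Real.log (n.factorial : ℝ) = Real.log n + Real.log (Real.Gamma n) := by
    rw [← Real.Gamma_nat_eq_factorial, Real.Gamma_add_one hpos.ne',
      Real.log_mul hpos.ne' (Real.Gamma_pos_of_pos hpos).ne']
  rw [Stirling.log_stirlingSeq_formula, hfac, stirlingRemainder,
    Real.log_mul two_ne_zero hpos.ne', Real.log_div hpos.ne' (Real.exp_pos 1).ne', Real.log_exp]
  ring

lemma tendsto_stirlingRemainder_natCast :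
    Tendsto (fun n : ℕ => stirlingRemainder n) atTop
      (𝓝 (Real.log √Real.pi + Real.log 2 / 2)) := by
  have hlim := (Stirling.tendsto_stirlingSeq_sqrt_pi.log
    (Real.sqrt_pos.mpr Real.pi_pos).ne').add_const (Real.log 2 / 2)
  refine hlim.congr' ?_
  filter_upwards [eventually_ne_atTop 0] with n hn
  exact (stirlingRemainder_natCast hn).symm

lemma log_Gamma_add_one {y : ℝ} (hy : 0 < y) :
    (Real.log ∘ Real.Gamma) (y + 1) = (Real.log ∘ Real.Gamma) y + Real.log y := by
  simp only [Function.comp_apply]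
  rw [Real.Gamma_add_one hy.ne', Real.log_mul hy.ne' (Real.Gamma_pos_of_pos hy).ne', add_comm]

lemma abs_stirlingRemainder_add_sub_le {n : ℕ} (hn : 2 ≤ n) {t : ℝ} (ht : 0 ≤ t) (ht1 : t ≤ 1) :
    |stirlingRemainder (n + t) - stirlingRemainder n| ≤ 2 / ((n : ℝ) - 1) := by
  have hn' : (2 : ℝ) ≤ n := by exact_mod_cast hn
  have hm : (0 : ℝ) < n - 1 := by linarith
  have hnpos : (0 : ℝ) < n := by linarith
  rcases ht.eq_or_lt with rfl | htpos
  · simp only [add_zero, sub_self, abs_zero]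
    positivity
  have hup := Real.BohrMollerup.f_add_nat_le Real.convexOn_log_Gamma log_Gamma_add_one
    (by omega : n ≠ 0) htpos ht1
  have hlow := Real.BohrMollerup.f_add_nat_ge Real.convexOn_log_Gamma log_Gamma_add_one hn htpos
  simp only [Function.comp_apply] at hup hlow
  have hpred : -(1 / ((n : ℝ) - 1)) ≤ Real.log ((n : ℝ) - 1) - Real.log n := by
    rw [← Real.log_div hm.ne' hnpos.ne']
    refine le_trans (le_of_eq ?_) (Real.one_sub_inv_le_log_of_pos (div_pos hm hnpos))
    field_simp
    ring
  have hpred' : -(1 / ((n : ℝ) - 1)) ≤ t * (Real.log ((n : ℝ) - 1) - Real.log n) := by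
    have : 0 ≤ 1 / ((n : ℝ) - 1) := by positivity
    nlinarith [mul_le_mul_of_nonneg_left hpred ht]
  have hntpos : 0 < (n : ℝ) + t := by linarith
  have hlog_le : Real.log (n + t) - Real.log n ≤ t / n := by
    rw [← Real.log_div hntpos.ne' hnpos.ne']
    refine (Real.log_le_sub_one_of_pos (div_pos hntpos hnpos)).trans (le_of_eq ?_)
    field_simp
    ring
  have hle_log : t / (n + t) ≤ Real.log (n + t) - Real.log n := by
    rw [← Real.log_div hntpos.ne' hnpos.ne']
    refine le_trans (le_of_eq ?_) (Real.one_sub_inv_le_log_of_pos (div_pos hntpos hnpos))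
    field_simp
    ring
  have hcoef : 0 ≤ (n : ℝ) + t - 1 / 2 := by linarith
  have hU := mul_le_mul_of_nonneg_left hlog_le hcoef
  have hL := mul_le_mul_of_nonneg_left hle_log hcoef
  have hinv : 1 / (n : ℝ) ≤ 1 / ((n : ℝ) - 1) := one_div_le_one_div_of_le hm (by linarith)
  have hU' : ((n : ℝ) + t - 1 / 2) * (t / n) ≤ t + 1 / n := by
    have : ((n : ℝ) + t - 1 / 2) * (t / n) = t + (t * (t - 1 / 2)) * (1 / n) := by
      field_simp
      ring
    rw [this]
    have : t * (t - 1 / 2) * (1 / n) ≤ 1 * (1 / (n : ℝ)) :=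
      mul_le_mul_of_nonneg_right (by nlinarith) (by positivity)
    linarith
  have hL' : t - 1 / n ≤ ((n : ℝ) + t - 1 / 2) * (t / (n + t)) := by
    have : ((n : ℝ) + t - 1 / 2) * (t / (n + t)) = t - t / 2 * (1 / (n + t)) := by
      field_simp
    rw [this]
    have : t / 2 * (1 / (n + t)) ≤ 1 * (1 / (n : ℝ)) :=
      mul_le_mul (by linarith) (one_div_le_one_div_of_le hnpos (by linarith))
        (by positivity) zero_le_one
    linarith
  have htwo : 2 / ((n : ℝ) - 1) = 1 / ((n : ℝ) - 1) + 1 / ((n : ℝ) - 1) := by ring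
  rw [htwo, abs_le]
  unfold stirlingRemainder
  constructor <;> linarith

lemma tendsto_stirlingRemainder :
    Tendsto stirlingRemainder atTop (𝓝 (Real.log √Real.pi + Real.log 2 / 2)) := by
  have hfloor : Tendsto (fun x : ℝ => ⌊x⌋₊) atTop atTop := tendsto_nat_floor_atTop
  have hbound : Tendsto (fun x : ℝ => 2 / ((⌊x⌋₊ : ℝ) - 1)) atTop (𝓝 0) :=
    tendsto_const_nhds.div_atTop
      (tendsto_atTop_add_const_right _ (-1) (tendsto_natCast_atTop_atTop.comp hfloor))
  have hdiff : Tendsto (fun x : ℝ => stirlingRemainder x - stirlingRemainder ⌊x⌋₊) atTop (𝓝 0) := by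
    refine squeeze_zero_norm' ?_ hbound
    filter_upwards [hfloor.eventually_ge_atTop 2, eventually_ge_atTop 0] with x hx hx0
    have h := abs_stirlingRemainder_add_sub_le hx (sub_nonneg.mpr (Nat.floor_le hx0))
      (by linarith [Nat.lt_floor_add_one x])
    rwa [add_sub_cancel] at h
  simpa using hdiff.add (tendsto_stirlingRemainder_natCast.comp hfloor)

lemma tendsto_stirlingRemainder_mul_sub {s : ℝ} (hs : 0 < s) :
    Tendsto (fun x => stirlingRemainder (x * s) - stirlingRemainder x) atTop (𝓝 0) := by
  simpa using (tendsto_stirlingRemainder.comp (tendsto_id.atTop_mul_const hs)).sub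
    tendsto_stirlingRemainder

lemma Gamma_mul_div_Gamma_eq_exp {x s : ℝ} (hx : 0 < x) (hs : 0 < s) :
    Real.Gamma (x * s) / Real.Gamma x =
      Real.exp ((stirlingRemainder (x * s) - stirlingRemainder x) +
        (s - 1) * (x * Real.log x) + x * (s * Real.log s - (s - 1)) - Real.log s / 2) := by
  rw [Gamma_eq_exp_stirlingRemainder (mul_pos hx hs), Gamma_eq_exp_stirlingRemainder hx,
    ← Real.exp_sub, Real.log_mul hx.ne' hs.ne']
  congr 1
  ring

lemma Gamma_ratio_prod_eq {ι : Type*} [Fintype ι] [Nonempty ι] {a : ι → ℝ} {N γ : ℝ}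
    (hγ : -1 < γ) (hN : 0 < N) (ha : ∀ i, 0 < a i) (hsum : ∑ i, a i = 1) :
    (∏ i, a i ^ a i) ^ (-(N * γ)) * (Real.Gamma N / Real.Gamma (N * (1 + γ))) *
        ∏ i, (Real.Gamma (N * a i * (1 + γ)) / Real.Gamma (N * a i)) =
      (1 + γ) ^ (-(((Fintype.card ι : ℝ) - 1) / 2)) *
        Real.exp (∑ i, (stirlingRemainder (N * a i * (1 + γ)) - stirlingRemainder (N * a i)) -
          (stirlingRemainder (N * (1 + γ)) - stirlingRemainder N)) := by
  have hs : 0 < 1 + γ := by linarith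
  have hC : ∏ i, a i ^ a i = Real.exp (∑ i, a i * Real.log (a i)) := by
    rw [Real.exp_sum]
    refine Finset.prod_congr rfl fun i _ => ?_
    rw [Real.rpow_def_of_pos (ha i), mul_comm]
  have hprod : ∏ i, (Real.Gamma (N * a i * (1 + γ)) / Real.Gamma (N * a i)) = Real.exp (∑ i,
      ((stirlingRemainder (N * a i * (1 + γ)) - stirlingRemainder (N * a i)) +
        (γ * N * Real.log N + N * ((1 + γ) * Real.log (1 + γ) - γ)) * a i +
        γ * N * (a i * Real.log (a i)) - Real.log (1 + γ) / 2)) := by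
    rw [Real.exp_sum]
    refine Finset.prod_congr rfl fun i _ => ?_
    rw [Gamma_mul_div_Gamma_eq_exp (mul_pos hN (ha i)) hs, Real.log_mul hN.ne' (ha i).ne']
    congr 1
    ring
  rw [hC, hprod, ← inv_div, Gamma_mul_div_Gamma_eq_exp hN hs, ← Real.exp_neg, ← Real.exp_mul,
    Real.rpow_def_of_pos hs, ← Real.exp_add, ← Real.exp_add, ← Real.exp_add]
  congr 1
  simp only [Finset.sum_sub_distrib, Finset.sum_add_distrib, ← Finset.mul_sum, hsum,
    Finset.sum_const, Finset.card_univ, nsmul_eq_mul]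
  ring

/-- Limit (A.7): with `n - k = ∑ (nᵢ - 1)`, `aᵢ = (nᵢ-1)/(n-k)`, `N = (n-k)/2` and
`C = ∏ aᵢ^{aᵢ}`, the quantity
`C^{-Nγ} (Γ(N)/Γ(N(1+γ))) ∏ᵢ Γ(Naᵢ(1+γ))/Γ(Naᵢ)` tends to `(1+γ)^{-(k-1)/2}`
as `min nᵢ → ∞`, uniformly in the sense of an `ε`–`M` statement. -/
theorem stmt_9 (k : ℕ) (hk : 2 ≤ k) (γ : ℝ) (hγ : -1 < γ) :
    ∀ ε > (0 : ℝ), ∃ M : ℕ, ∀ n : Fin k → ℕ, (∀ i, 2 ≤ n i) → (∀ i, M ≤ n i) →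
      ∀ (nk : ℝ), nk = ∑ i, ((n i : ℝ) - 1) →
      ∀ (a : Fin k → ℝ), a = (fun i => ((n i : ℝ) - 1) / nk) →
      ∀ (N : ℝ), N = nk / 2 →
      ∀ (C : ℝ), C = ∏ i, (a i) ^ (a i) →
      |C ^ (-(N * γ)) * (Real.Gamma N / Real.Gamma (N * (1 + γ)))
          * ∏ i, (Real.Gamma (N * a i * (1 + γ)) / Real.Gamma (N * a i))
        - (1 + γ) ^ (-(((k : ℝ) - 1) / 2))| < ε := by
  intro ε hε
  have : NeZero k := ⟨by omega⟩
  have hcont : Tendsto (fun y : ℝ => (1 + γ) ^ (-(((k : ℝ) - 1) / 2)) * Real.exp y) (𝓝 0)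
      (𝓝 ((1 + γ) ^ (-(((k : ℝ) - 1) / 2)))) := by
    simpa using (Real.continuous_exp.tendsto 0).const_mul ((1 + γ) ^ (-(((k : ℝ) - 1) / 2)))
  obtain ⟨δ, hδ, hexp⟩ := Metric.tendsto_nhds_nhds.mp hcont ε hε
  have hη : 0 < δ / (k + 1) := by positivity
  obtain ⟨X, hX⟩ := Metric.tendsto_atTop.mp
    (tendsto_stirlingRemainder_mul_sub (by linarith : 0 < 1 + γ)) _ hη
  simp only [Real.dist_eq, sub_zero] at hX hexp
  obtain ⟨M, hM⟩ := exists_nat_ge (2 * X + 1)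
  refine ⟨M, ?_⟩
  rintro n hn2 hnM nk hnk a rfl N rfl C rfl
  have hpos (i) : 0 < (n i : ℝ) - 1 := by
    have : (2 : ℝ) ≤ n i := by exact_mod_cast hn2 i
    linarith
  have hnkpos : 0 < nk := hnk ▸ Finset.sum_pos (fun i _ => hpos i) univ_nonempty
  have hXi (i) : X ≤ ((n i : ℝ) - 1) / 2 := by
    have : (M : ℝ) ≤ n i := by exact_mod_cast hnM i
    linarith
  have hmul (i) : nk / 2 * (((n i : ℝ) - 1) / nk) = ((n i : ℝ) - 1) / 2 := by
    field_simp
  have hXN : X ≤ nk / 2 := by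
    refine (hXi 0).trans ?_
    have := Finset.single_le_sum (f := fun i => (n i : ℝ) - 1) (fun i _ => (hpos i).le)
      (mem_univ 0)
    rw [hnk]
    linarith
  have hratio := Gamma_ratio_prod_eq hγ (half_pos hnkpos) (fun i => div_pos (hpos i) hnkpos)
    (by rw [← Finset.sum_div, ← hnk, div_self hnkpos.ne'])
  rw [Fintype.card_fin] at hratio
  rw [hratio]
  apply hexp
  refine (abs_sub _ _).trans_lt ?_
  calc _ < k * (δ / (k + 1)) + δ / (k + 1) := by
        refine add_lt_add_of_le_of_lt ?_ (hX _ hXN)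
        refine (Finset.abs_sum_le_sum_abs _ _).trans ?_
        refine (Finset.sum_le_card_nsmul _ _ (δ / (k + 1)) fun i _ => ?_).trans_eq (by simp)
        rw [hmul]
        exact (hX _ (hXi i)).le
    _ = δ := by field_simp
end

section
/- Let k ≥ 2 be an integer and let X be a random variable on a probability space with X > 0 almost surely. Then the law of −2 log X is the chi-squared distribution with k−1 degrees of freedom (i.e., the Gamma distribution with shape (k−1)/2 and rate 1/2) if and only if for every real γ > −1 the random variable X^γ is integrable and E[X^γ] = (1+γ)^{−(k−1)/2}. -/
open MeasureTheory ProbabilityTheory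

/-- Two finite measures on `ℝ` with finite exponential moments around `0`, whose
moment-generating functions coincide near `0`, are equal. -/
theorem measure_ext_of_mgf_eventuallyEq {ν ν' : Measure ℝ} [IsFiniteMeasure ν]
    [IsFiniteMeasure ν'] (hν : 0 ∈ interior (integrableExpSet id ν))
    (hν' : 0 ∈ interior (integrableExpSet id ν'))
    (h : ∀ᶠ t in nhds 0, mgf id ν t = mgf id ν' t) : ν = ν' := by
  set S : Set ℝ := interior (integrableExpSet id ν) ∩ interior (integrableExpSet id ν')
  have hS : IsPreconnected {z : ℂ | z.re ∈ S} :=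
    ((convex_integrableExpSet.interior.inter
      convex_integrableExpSet.interior).linear_preimage Complex.reLm).isPreconnected
  have hf : AnalyticOnNhd ℂ (complexMGF id ν) {z | z.re ∈ S} :=
    analyticOnNhd_complexMGF.mono fun _ hz ↦ hz.1
  have hg : AnalyticOnNhd ℂ (complexMGF id ν') {z | z.re ∈ S} :=
    analyticOnNhd_complexMGF.mono fun _ hz ↦ hz.2
  have hfreq : ∃ᶠ z in nhdsWithin (0 : ℂ) {0}ᶜ, complexMGF id ν z = complexMGF id ν' z := by
    have htend : Filter.Tendsto (fun t : ℝ ↦ (t : ℂ)) (nhdsWithin 0 {0}ᶜ)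
        (nhdsWithin 0 {0}ᶜ) := by
      refine tendsto_nhdsWithin_of_tendsto_nhds_of_eventually_within _ ?_ ?_
      · exact (Complex.continuous_ofReal.tendsto' 0 0 Complex.ofReal_zero).mono_left
          nhdsWithin_le_nhds
      · filter_upwards [self_mem_nhdsWithin] with t ht
        simpa using ht
    refine htend.frequently (Filter.Eventually.frequently ?_)
    filter_upwards [h.filter_mono nhdsWithin_le_nhds] with t ht
    rw [complexMGF_ofReal, complexMGF_ofReal, ht]
  have heq := hf.eqOn_of_preconnected_of_frequently_eq hg hS (z₀ := 0)
    (by simpa using ⟨hν, hν'⟩) hfreq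
  refine Measure.ext_of_charFun (funext fun t ↦ ?_)
  rw [← complexMGF_id_mul_I, ← complexMGF_id_mul_I]
  exact heq (by simpa using ⟨hν, hν'⟩)

/-- Exponentially tilting a gamma density changes its rate. -/
theorem exp_mul_gammaPDFReal {a r t : ℝ} (hr : 0 < r) (ht : t < r) (x : ℝ) :
    Real.exp (t * x) * gammaPDFReal a r x =
      (r / (r - t)) ^ a * gammaPDFReal a (r - t) x := by
  have hrt : 0 < r - t := sub_pos.mpr ht
  unfold gammaPDFReal
  split_ifs
  · have hexp : Real.exp (-((r - t) * x)) = Real.exp (t * x) * Real.exp (-(r * x)) := by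
      rw [← Real.exp_add]
      ring_nf
    have hpow : (r - t) ^ a ≠ 0 := (Real.rpow_pos_of_pos hrt a).ne'
    rw [hexp, Real.div_rpow hr.le hrt.le]
    field_simp
  · simp

theorem lintegral_exp_mul_gammaMeasure {a r t : ℝ} (ha : 0 < a) (hr : 0 < r) (ht : t < r) :
    ∫⁻ x, ENNReal.ofReal (Real.exp (t * x)) ∂(gammaMeasure a r) =
      ENNReal.ofReal ((r / (r - t)) ^ a) := by
  have hrt : 0 < r - t := sub_pos.mpr ht
  have hpdf (s : ℝ) : Measurable (gammaPDF a s) :=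
    (measurable_gammaPDFReal a s).ennreal_ofReal
  rw [gammaMeasure, lintegral_withDensity_eq_lintegral_mul _ (hpdf r) (by fun_prop)]
  have hpt (x : ℝ) : (gammaPDF a r * fun x ↦ ENNReal.ofReal (Real.exp (t * x))) x =
      ENNReal.ofReal ((r / (r - t)) ^ a) * gammaPDF a (r - t) x := by
    rw [Pi.mul_apply, mul_comm, gammaPDF, gammaPDF, ← ENNReal.ofReal_mul (Real.exp_pos _).le,
      ← ENNReal.ofReal_mul (by positivity), exp_mul_gammaPDFReal hr ht]
  rw [lintegral_congr hpt, lintegral_const_mul _ (hpdf _),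
    lintegral_gammaPDF_eq_one ha hrt, mul_one]

theorem integrable_exp_mul_gammaMeasure {a r t : ℝ} (ha : 0 < a) (hr : 0 < r) (ht : t < r) :
    Integrable (fun x ↦ Real.exp (t * x)) (gammaMeasure a r) := by
  refine ⟨by fun_prop, ?_⟩
  rw [hasFiniteIntegral_iff_ofReal (ae_of_all _ fun _ ↦ (Real.exp_pos _).le),
    lintegral_exp_mul_gammaMeasure ha hr ht]
  exact ENNReal.ofReal_lt_top

theorem mgf_id_gammaMeasure {a r t : ℝ} (ha : 0 < a) (hr : 0 < r) (ht : t < r) :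
    mgf id (gammaMeasure a r) t = (r / (r - t)) ^ a := by
  have hrt : 0 < r - t := sub_pos.mpr ht
  simp only [mgf, id_eq]
  rw [integral_eq_lintegral_of_nonneg_ae (ae_of_all _ fun _ ↦ (Real.exp_pos _).le)
      (by fun_prop), lintegral_exp_mul_gammaMeasure ha hr ht,
    ENNReal.toReal_ofReal (by positivity)]

/-- Among probability measures, the gamma distribution is characterized by its
moment-generating function to the left of its rate. -/
theorem eq_gammaMeasure_iff_mgf {a r : ℝ} (ha : 0 < a) (hr : 0 < r) (ν : Measure ℝ)
    [IsProbabilityMeasure ν] :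
    ν = gammaMeasure a r ↔ ∀ t < r, Integrable (fun x ↦ Real.exp (t * x)) ν ∧
      mgf id ν t = (r / (r - t)) ^ a := by
  have := isProbabilityMeasure_gammaMeasure ha hr
  constructor
  · rintro rfl t ht
    exact ⟨integrable_exp_mul_gammaMeasure ha hr ht, mgf_id_gammaMeasure ha hr ht⟩
  · intro h
    have hnhds : Set.Iio r ∈ nhds (0 : ℝ) := Iio_mem_nhds hr
    refine measure_ext_of_mgf_eventuallyEq ?_ ?_ ?_
    · exact mem_interior_iff_mem_nhds.mpr (Filter.mem_of_superset hnhds fun t ht ↦ (h t ht).1)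
    · exact mem_interior_iff_mem_nhds.mpr (Filter.mem_of_superset hnhds fun t ht ↦
        integrable_exp_mul_gammaMeasure ha hr ht)
    · filter_upwards [hnhds] with t ht
      rw [(h t ht).2, mgf_id_gammaMeasure ha hr ht]

/-- Moment characterization: for `k ≥ 2` and a random variable `X > 0` a.s., the law of
`-2 log X` is chi-squared with `k-1` degrees of freedom (Gamma with shape `(k-1)/2`,
rate `1/2`) iff for every `γ > -1`, `X^γ` is integrable and
`E[X^γ] = (1+γ)^{-(k-1)/2}`. -/
theorem stmt_13 {Ω : Type*} [MeasurableSpace Ω] (μ : Measure Ω) [IsProbabilityMeasure μ]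
    (k : ℕ) (hk : 2 ≤ k) (X : Ω → ℝ) (hmeas : Measurable X)
    (hpos : ∀ᵐ ω ∂μ, 0 < X ω) :
    Measure.map (fun ω => -2 * Real.log (X ω)) μ
        = gammaMeasure (((k : ℝ) - 1) / 2) (1 / 2) ↔
      ∀ γ : ℝ, -1 < γ →
        Integrable (fun ω => X ω ^ γ) μ ∧
          ∫ ω, X ω ^ γ ∂μ = (1 + γ) ^ (-(((k : ℝ) - 1) / 2)) := by
  have hY : Measurable fun ω ↦ -2 * Real.log (X ω) := by fun_prop
  have ha : 0 < ((k : ℝ) - 1) / 2 := by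
    have : (2 : ℝ) ≤ k := by exact_mod_cast hk
    linarith
  have := Measure.isProbabilityMeasure_map (μ := μ) hY.aemeasurable
  have hpow (t : ℝ) : (fun ω ↦ X ω ^ (-2 * t)) =ᵐ[μ]
      fun ω ↦ Real.exp (t * (-2 * Real.log (X ω))) := by
    filter_upwards [hpos] with ω hω
    rw [Real.rpow_def_of_pos hω]
    ring_nf
  have hval (t : ℝ) (ht : t < 1 / 2) : (1 / 2 / (1 / 2 - t)) ^ (((k : ℝ) - 1) / 2) =
      (1 + -2 * t) ^ (-(((k : ℝ) - 1) / 2)) := by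
    have hbase : (1 / 2 / (1 / 2 - t)) = (1 + -2 * t)⁻¹ := by
      have h₁ : 1 / 2 - t ≠ 0 := by linarith
      have h₂ : 1 + -2 * t ≠ 0 := by linarith
      field_simp
      ring
    rw [hbase, Real.inv_rpow (by linarith), Real.rpow_neg (by linarith)]
  have hmoment (t : ℝ) (ht : t < 1 / 2) :
      (Integrable (fun x ↦ Real.exp (t * x)) (μ.map fun ω ↦ -2 * Real.log (X ω)) ∧
        mgf id (μ.map fun ω ↦ -2 * Real.log (X ω)) t =
          (1 / 2 / (1 / 2 - t)) ^ (((k : ℝ) - 1) / 2)) ↔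
      Integrable (fun ω ↦ X ω ^ (-2 * t)) μ ∧
        ∫ ω, X ω ^ (-2 * t) ∂μ = (1 + -2 * t) ^ (-(((k : ℝ) - 1) / 2)) := by
    rw [integrable_map_measure (by fun_prop) hY.aemeasurable, mgf_id_map hY.aemeasurable,
      hval t ht, integrable_congr (hpow t), integral_congr_ae (hpow t)]
    rfl
  rw [eq_gammaMeasure_iff_mgf ha (by norm_num)]
  constructor
  · intro h γ hγ
    have ht : -γ / 2 < 1 / 2 := by linarith
    have := (hmoment _ ht).mp (h _ ht)
    rwa [show -2 * (-γ / 2) = γ by ring] at this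
  · exact fun h t ht ↦ (hmoment t ht).mpr (h _ (by linarith))
end
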